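/- For all positive integers s_A, t_A, s_D, t_B and Δ there exist constants q and ξ', depending only on s_A, t_A, s_D, t_B and Δ, with the following property. For every n ≥ 1, all integer matrices A (s_A×t_A), B (s_A×t_B), D (s_D×t_A) with entries of absolute value at most Δ, and every y ∈ Z^{t_B + n·t_A} with H_0·y = 0 (H_0 the 3-block n-fold matrix built from A, B, D), there exist vectors e_1, …, e_q ∈ Z^{t_B + n·t_A}, nonnegative integers α_1, …, α_q and β_ℓ, and at most 2·n·t_A − 1 vectors d_ℓ = (0, g_ℓ(E)) with g_ℓ(E) in the Graver basis G(E) of the n-fold matrix E built from D and A, such that: H_0·e_h = 0, e_h^0 ⊑ y^0 and ‖e_h‖_∞ ≤ ξ' for every h; y = Σ_h α_h e_h + Σ_ℓ β_ℓ d_ℓ; the vectors e_1, …, e_q are pairwise sign-compatible; and the vectors d_ℓ are pairwise sign-compatible. -/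

import Mathlib

/-- `x ⊑ y`: `|x i| ≤ |y i|` and `x i · y i ≥ 0` for every coordinate `i`. -/
def conformal {m : Type*} (x y : m → ℤ) : Prop :=
  ∀ i, |x i| ≤ |y i| ∧ 0 ≤ x i * y i

/-- The Graver basis of an integer matrix `M`: the `⊑`-minimal elements of
`{x : M x = 0, x ≠ 0}`. -/
def graverBasis {R C : Type*} [Fintype C] (M : Matrix R C ℤ) : Set (C → ℤ) :=
  {g | M.mulVec g = 0 ∧ g ≠ 0 ∧
    ∀ z : C → ℤ, M.mulVec z = 0 → z ≠ 0 → conformal z g → z = g}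

/-- The 3-block n-fold matrix built from `A, B, D`. -/
def threeBlock (n sA tA sD tB : ℕ)
    (A : Matrix (Fin sA) (Fin tA) ℤ) (B : Matrix (Fin sA) (Fin tB) ℤ)
    (D : Matrix (Fin sD) (Fin tA) ℤ) :
    Matrix (Fin sD ⊕ Fin n × Fin sA) (Fin tB ⊕ Fin n × Fin tA) ℤ :=
  Matrix.of fun r c =>
    match r, c with
    | Sum.inl _, Sum.inl _ => 0
    | Sum.inl i, Sum.inr (_, j) => D i j
    | Sum.inr (_, i), Sum.inl j => B i j
    | Sum.inr (k, i), Sum.inr (l, j) => if k = l then A i j else 0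

/-- The n-fold matrix built from `D` and `A`. -/
def nfold (n sA tA sD : ℕ)
    (D : Matrix (Fin sD) (Fin tA) ℤ) (A : Matrix (Fin sA) (Fin tA) ℤ) :
    Matrix (Fin sD ⊕ Fin n × Fin sA) (Fin n × Fin tA) ℤ :=
  Matrix.of fun r c =>
    match r, c with
    | Sum.inl i, (_, j) => D i j
    | Sum.inr (k, i), (l, j) => if k = l then A i j else 0


theorem conformal_trans' {ι : Type*} {x y z : ι → ℤ} (h1 : conformal x y) (h2 : conformal y z) :
    conformal x z := by
  intro i
  obtain ⟨a, b⟩ := h1 i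
  obtain ⟨c, d⟩ := h2 i
  refine ⟨a.trans c, ?_⟩
  by_cases hy : y i = 0
  · have : x i = 0 := by simpa [hy] using a
    simp [this]
  · have : 0 < y i * y i := mul_self_pos.2 hy
    nlinarith [mul_nonneg b d]

theorem conformal_iff_nat {ι : Type*} {x y : ι → ℤ} :
    conformal x y ↔ ∀ i, (x i).toNat ≤ (y i).toNat ∧ (-x i).toNat ≤ (-y i).toNat := by
  constructor
  · intro h i
    obtain ⟨a, b⟩ := h i
    rcases le_total 0 (y i) with hy | hy
    · rcases le_or_gt 0 (x i) with hx | hx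
      · rw [abs_of_nonneg hx, abs_of_nonneg hy] at a; omega
      · rcases hy.lt_or_eq with h | h
        · nlinarith
        · rw [← h] at a; simp at a; omega
    · rcases le_or_gt (x i) 0 with hx | hx
      · rw [abs_of_nonpos hx, abs_of_nonpos hy] at a; omega
      · rcases hy.lt_or_eq with h | h
        · nlinarith
        · rw [h] at a; simp at a; omega
  · intro h i
    obtain ⟨a, b⟩ := h i
    rcases le_total 0 (y i) with hy | hy
    · have hx : 0 ≤ x i := by omega
      rw [abs_of_nonneg hx, abs_of_nonneg hy]
      exact ⟨by omega, mul_nonneg hx hy⟩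
    · have hx : x i ≤ 0 := by omega
      rw [abs_of_nonpos hx, abs_of_nonpos hy]
      exact ⟨by omega, mul_nonneg_of_nonpos_of_nonpos hx hy⟩

def lgraver {ι : Type*} (Λ : AddSubgroup (ι → ℤ)) : Set (ι → ℤ) :=
  {g | g ∈ Λ ∧ g ≠ 0 ∧ ∀ z ∈ Λ, z ≠ 0 → conformal z g → z = g}

theorem lgraver_finite {ι : Type*} [Finite ι] (Λ : AddSubgroup (ι → ℤ)) :
    (lgraver Λ).Finite := by
  let φ : (ι → ℤ) → (ι → ℕ × ℕ) := fun x i => ((x i).toNat, (-x i).toNat)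
  have hφ : ∀ x y, φ x ≤ φ y ↔ conformal x y := by
    intro x y
    rw [conformal_iff_nat]
    rfl
  have hinj : Function.Injective φ := by
    intro x y h
    funext i
    have := congrFun h i
    simp only [φ, Prod.mk.injEq] at this
    omega
  refine Set.Finite.of_finite_image (f := φ) ?_ hinj.injOn
  have hanti : IsAntichain (· ≤ ·) (φ '' lgraver Λ) := by
    rintro _ ⟨x, hx, rfl⟩ _ ⟨y, hy, rfl⟩ hne hle
    exact hne (congrArg φ (hy.2.2 x hx.1 hx.2.1 ((hφ x y).1 hle)))
  exact hanti.finite_of_partiallyWellOrderedOn (Set.isPWO_of_wellQuasiOrderedLE _)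

theorem lgraver_decomp {ι : Type*} [Fintype ι] (Λ : AddSubgroup (ι → ℤ)) :
    ∀ (N : ℕ) (w : ι → ℤ), w ∈ Λ → ∑ i, (w i).natAbs ≤ N →
      ∃ c : (ι → ℤ) →₀ ℕ, (∀ g ∈ c.support, g ∈ lgraver Λ ∧ conformal g w) ∧
        c.sum (fun g k => (k : ℤ) • g) = w := by
  intro N
  induction N with
  | zero =>
    intro w hw hN
    refine ⟨0, by simp, ?_⟩
    have : ∀ i, w i = 0 := by simpa using hN
    funext i; simp [this]
  | succ N ih =>
    intro w hw hN
    by_cases hw0 : w = 0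
    · exact ⟨0, by simp, by simp [hw0]⟩
    classical
    have hex : ∃ k : ℕ, ∃ z ∈ Λ, z ≠ 0 ∧ conformal z w ∧ ∑ i, (z i).natAbs = k :=
      ⟨_, w, hw, hw0, fun i => ⟨le_rfl, mul_self_nonneg _⟩, rfl⟩
    obtain ⟨g, hg, hg0, hgw, hgk⟩ := Nat.find_spec hex
    have hgG : g ∈ lgraver Λ := by
      refine ⟨hg, hg0, fun z hz hz0 hzg => ?_⟩
      have h1 := Nat.find_min' hex ⟨z, hz, hz0, conformal_trans' hzg hgw, rfl⟩
      rw [← hgk] at h1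
      have h2 : ∀ i ∈ Finset.univ, (z i).natAbs ≤ (g i).natAbs := fun i _ => by
        have := conformal_iff_nat.1 hzg i; omega
      have h3 := (Finset.sum_eq_sum_iff_of_le h2).1 (le_antisymm (Finset.sum_le_sum h2) h1)
      funext i
      have := conformal_iff_nat.1 hzg i
      have := h3 i (Finset.mem_univ i)
      omega
    have hsub : conformal (w - g) w := by
      rw [conformal_iff_nat]; intro i
      have := conformal_iff_nat.1 hgw i
      simp only [Pi.sub_apply]; omega
    have hlt : ∑ i, ((w - g) i).natAbs < ∑ i, (w i).natAbs := by
      obtain ⟨j, hj⟩ := Function.ne_iff.1 hg0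
      refine Finset.sum_lt_sum (fun i _ => ?_) ⟨j, Finset.mem_univ j, ?_⟩
      · have := conformal_iff_nat.1 hgw i
        simp only [Pi.sub_apply]; omega
      · have := conformal_iff_nat.1 hgw j
        simp only [Pi.sub_apply, Pi.zero_apply] at hj ⊢; omega
    obtain ⟨c, hc, hcs⟩ := ih (w - g) (Λ.sub_mem hw hg) (by omega)
    refine ⟨c + Finsupp.single g 1, ?_, ?_⟩
    · intro u hu
      rcases Finset.mem_union.1 (Finsupp.support_add hu) with h | h
      · exact ⟨(hc u h).1, conformal_trans' (hc u h).2 hsub⟩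
      · have : u = g := by simpa using Finsupp.support_single_subset h
        subst this; exact ⟨hgG, hgw⟩
    · rw [Finsupp.sum_add_index' (by simp) (by intros; push_cast; rw [add_smul]), hcs,
        Finsupp.sum_single_index (by simp)]
      simp

theorem cfs_opt {κ ι : Type*} [Fintype κ] [Fintype ι] (g : κ → ι → ℝ) (f : ι → ℝ)
    (hf : ∀ k, 1 ≤ ∑ i, f i * g k i) (z : ι → ℝ) (c0 : κ → ℝ) (hc0 : ∀ k, 0 ≤ c0 k)
    (hc0z : ∑ k, c0 k • g k = z) :
    ∃ l : κ → ℝ, (∀ k, 0 ≤ l k) ∧ ∑ k, l k • g k = z ∧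
      (∀ m : κ → ℝ, (∀ k, 0 ≤ m k) → ∑ k, m k • g k = z → ∑ k, m k ≤ ∑ k, l k) ∧
      (Finset.univ.filter (fun k => l k ≠ 0)).card ≤ Fintype.card ι := by
  classical
  let F : Set (κ → ℝ) := {m | (∀ k, 0 ≤ m k) ∧ ∑ k, m k • g k = z}
  have hclosed : IsClosed F := by
    have h1 : IsClosed {m : κ → ℝ | ∀ k, 0 ≤ m k} := by
      simp only [Set.ofPred_forall]
      exact isClosed_iInter fun k => isClosed_le continuous_const (continuous_apply k)
    have h2 : IsClosed {m : κ → ℝ | ∑ k, m k • g k = z} :=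
      isClosed_eq (by fun_prop) continuous_const
    exact h1.inter h2
  have hsub : F ⊆ Set.Icc 0 (fun _ => ∑ i, f i * z i) := by
    rintro m ⟨hm0, hmz⟩
    refine ⟨hm0, fun k => ?_⟩
    have : ∑ i, f i * z i = ∑ k, m k * ∑ i, f i * g k i := by
      rw [← hmz]
      simp only [Finset.sum_apply, Pi.smul_apply, smul_eq_mul, Finset.mul_sum]
      rw [Finset.sum_comm]
      refine Finset.sum_congr rfl fun k _ => Finset.sum_congr rfl fun i _ => by ring
    simp only
    rw [this]
    calc m k ≤ m k * ∑ i, f i * g k i := le_mul_of_one_le_right (hm0 k) (hf k)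
      _ ≤ _ := Finset.single_le_sum (f := fun k => m k * ∑ i, f i * g k i)
        (fun k _ => mul_nonneg (hm0 k) (zero_le_one.trans (hf k))) (Finset.mem_univ k)
  have hcomp : IsCompact F := isCompact_Icc.of_isClosed_subset hclosed hsub
  obtain ⟨l0, hl0, hmax0⟩ := hcomp.exists_isMaxOn (f := fun m => ∑ k, m k) ⟨c0, hc0, hc0z⟩
    (by fun_prop)
  have hex : ∃ N : ℕ, ∃ l ∈ F, (∀ m ∈ F, ∑ k, m k ≤ ∑ k, l k) ∧
      (Finset.univ.filter (fun k => l k ≠ 0)).card = N :=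
    ⟨_, l0, hl0, fun m hm => hmax0 hm, rfl⟩
  obtain ⟨l, hl, hmax, hcard⟩ := Nat.find_spec hex
  refine ⟨l, hl.1, hl.2, fun m h1 h2 => hmax m ⟨h1, h2⟩, ?_⟩
  set S := Finset.univ.filter (fun k => l k ≠ 0) with hS
  by_contra hlt
  push Not at hlt
  -- linear dependence
  have hdep : ∃ u : κ → ℝ, (∀ k, l k = 0 → u k = 0) ∧ ∑ k, u k • g k = 0 ∧ (∃ k, u k ≠ 0) := by
    have hnl : ¬ LinearIndependent ℝ (fun k : S => g k) := by
      intro h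
      have := h.fintype_card_le_finrank
      simp at this
      omega
    rw [Fintype.not_linearIndependent_iff] at hnl
    obtain ⟨v, hv, ⟨k0, hk0⟩⟩ := hnl
    refine ⟨fun k => if h : k ∈ S then v ⟨k, h⟩ else 0, ?_, ?_, ⟨k0, ?_⟩⟩
    · intro k hk
      have : k ∉ S := by simp [hS, hk]
      simp [this]
    · rw [← hv, ← Finset.sum_subset (Finset.subset_univ S), ← Finset.sum_coe_sort S]
      · refine Finset.sum_congr rfl fun k _ => ?_
        simp
      · intro k _ hk
        simp [hk]
    · simpa using hk0
  have hdep2 : ∃ u : κ → ℝ, (∀ k, l k = 0 → u k = 0) ∧ ∑ k, u k • g k = 0 ∧ (∃ k, u k ≠ 0) ∧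
      ∑ k, u k ≤ 0 := by
    obtain ⟨u, h1, h2, k, h3⟩ := hdep
    rcases le_total (∑ k, u k) 0 with h | h
    · exact ⟨u, h1, h2, ⟨k, h3⟩, h⟩
    · refine ⟨-u, fun k hk => by simp [h1 k hk], ?_, ⟨k, by simpa using h3⟩, by simpa using h⟩
      simpa using h2
  obtain ⟨u, hu0, hus, ⟨k1, hk1⟩, hle⟩ := hdep2
  have hfeas : ∀ t : ℝ, ∑ k, (l k - t * u k) • g k = z := by
    intro t
    have : ∑ k, (l k - t * u k) • g k = ∑ k, l k • g k - t • ∑ k, u k • g k := by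
      rw [Finset.smul_sum, ← Finset.sum_sub_distrib]
      exact Finset.sum_congr rfl fun k _ => by rw [sub_smul, mul_smul]
    rw [this, hus, hl.2]; simp
  have hsum : ∀ t : ℝ, ∑ k, (l k - t * u k) = ∑ k, l k - t * ∑ k, u k := by
    intro t
    rw [Finset.mul_sum, ← Finset.sum_sub_distrib]
  by_cases hpos : ∃ k, 0 < u k
  · obtain ⟨k2, hk2, hmin⟩ := Finset.exists_min_image (Finset.univ.filter (fun k => 0 < u k))
      (fun k => l k / u k) (by obtain ⟨k, hk⟩ := hpos; exact ⟨k, by simp [hk]⟩)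
    have hk2' : 0 < u k2 := by simpa using hk2
    set t := l k2 / u k2 with ht
    have ht0 : 0 ≤ t := div_nonneg (hl.1 _) hk2'.le
    have hmem : (fun k => l k - t * u k) ∈ F := by
      refine ⟨fun k => ?_, hfeas t⟩
      rcases le_or_gt (u k) 0 with h | h
      · have := hl.1 k
        have := mul_nonneg ht0 (neg_nonneg.2 h)
        simp only
        linarith
      · have := hmin k (by simp [h])
        simp only [sub_nonneg]
        rwa [le_div_iff₀ h] at this
    have hge : ∑ k, l k ≤ ∑ k, (l k - t * u k) := by
      rw [hsum]; nlinarith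
    have hm := Nat.find_min' hex ⟨_, hmem, fun m hm => (hmax m hm).trans hge, rfl⟩
    rw [← hcard] at hm
    refine absurd hm (not_le.2 (Finset.card_lt_card ?_))
    refine Finset.ssubset_iff_of_subset ?_ |>.2 ⟨k2, ?_, ?_⟩
    · intro k hk
      simp only [Finset.mem_filter, Finset.mem_univ, true_and, hS] at hk ⊢
      intro h
      exact hk (by simp [h, hu0 k h])
    · simp only [Finset.mem_filter, Finset.mem_univ, true_and, hS]
      intro h
      exact hk2'.ne' (hu0 _ h)
    · simp only [Finset.mem_filter, Finset.mem_univ, true_and, not_not]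
      rw [ht]; field_simp; simp
  · push Not at hpos
    have hneg : ∑ k, u k < 0 := by
      refine Finset.sum_neg' (fun k _ => hpos k) ⟨k1, Finset.mem_univ _, lt_of_le_of_ne (hpos _) hk1⟩
    have hmem : (fun k => l k - 1 * u k) ∈ F :=
      ⟨fun k => by have := hpos k; have := hl.1 k; simp only; linarith, hfeas 1⟩
    have := hmax _ hmem
    rw [hsum] at this
    linarith

theorem cfs {ι : Type*} [Fintype ι] (Λ : AddSubgroup (ι → ℤ)) (hι : 0 < Fintype.card ι)
    (z : ι → ℤ) (hz : z ∈ Λ) :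
    ∃ c : (ι → ℤ) →₀ ℕ, (∀ g ∈ c.support, g ∈ lgraver Λ) ∧
      (∀ g ∈ c.support, ∀ g' ∈ c.support, ∀ i, 0 ≤ g i * g' i) ∧
      c.support.card ≤ 2 * Fintype.card ι - 1 ∧
      c.sum (fun g k => (k : ℤ) • g) = z := by
  classical
  let σ : ι → ℤ := fun i => if 0 ≤ z i then 1 else -1
  have hσσ : ∀ i, σ i * σ i = 1 := by intro i; simp only [σ]; split_ifs <;> simp
  let G : Set (ι → ℤ) := {g | g ∈ lgraver Λ ∧ ∀ i, 0 ≤ σ i * g i}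
  have hGfin : G.Finite := (lgraver_finite Λ).subset fun g hg => hg.1
  have : Fintype G := hGfin.fintype
  have hσconf : ∀ w : ι → ℤ, (∀ i, 0 ≤ σ i * w i) → ∀ g, conformal g w → ∀ i, 0 ≤ σ i * g i := by
    intro w hw g hg i
    have h1 := hw i
    have h2 := conformal_iff_nat.1 hg i
    simp only [σ] at h1 ⊢
    split_ifs at h1 ⊢ <;> omega
  -- decompositions within G
  have hdec : ∀ w ∈ Λ, (∀ i, 0 ≤ σ i * w i) → ∃ c : G → ℕ, ∑ k, (c k : ℤ) • k.1 = w := by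
    intro w hw hs
    obtain ⟨c, hc, hcs⟩ := lgraver_decomp Λ _ w hw le_rfl
    refine ⟨fun k => c k.1, ?_⟩
    rw [← hcs, Finsupp.sum]
    have hsub : c.support ⊆ hGfin.toFinset := by
      intro g hg
      rw [Set.Finite.mem_toFinset]
      exact ⟨(hc g hg).1, hσconf w hs g (hc g hg).2⟩
    rw [Finset.sum_subset hsub (by intro x _ hx; simp [Finsupp.notMem_support_iff.1 hx])]
    exact (Finset.sum_subtype hGfin.toFinset (p := fun x => x ∈ G) (by simp) (fun g => (c g : ℤ) • g)).symm
  have hzσ : ∀ i, 0 ≤ σ i * z i := by intro i; simp only [σ]; split_ifs <;> omega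
  obtain ⟨c0, hc0⟩ := hdec z hz hzσ
  have hcast : ∀ (c : G → ℤ) (w : ι → ℤ), ∑ k, c k • k.1 = w →
      ∑ k, (c k : ℝ) • (fun i => (k.1 i : ℝ)) = fun i => (w i : ℝ) := by
    intro c w h
    funext i
    rw [← h]
    simp
  obtain ⟨l, hl0, hlz, hlmax, hlcard⟩ := cfs_opt (κ := G) (fun k i => (k.1 i : ℝ))
    (fun i => (σ i : ℝ)) (by
      intro k
      have h : 1 ≤ ∑ i, σ i * k.1 i := by
        have hk := k.2
        obtain ⟨j, hj⟩ := Function.ne_iff.1 hk.1.2.1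
        have h1 : σ j * k.1 j ≤ ∑ i, σ i * k.1 i :=
          Finset.single_le_sum (f := fun i => σ i * k.1 i) (fun i _ => hk.2 i) (Finset.mem_univ j)
        have h2 : σ j * k.1 j ≠ 0 := by
          refine mul_ne_zero (fun h => ?_) hj
          have := hσσ j; simp [h] at this
        have := hk.2 j
        omega
      exact_mod_cast h) (fun i => (z i : ℝ)) (fun k => (c0 k : ℝ)) (fun k => by positivity)
      (by simpa using hcast (fun k => (c0 k : ℤ)) z hc0)
  let w : ι → ℤ := z - ∑ k, (⌊l k⌋₊ : ℤ) • k.1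
  have hwΛ : w ∈ Λ := Λ.sub_mem hz (Λ.sum_mem fun k _ => Λ.zsmul_mem k.2.1.1 _)
  have hwr : ∀ i, (w i : ℝ) = ∑ k, (l k - ⌊l k⌋₊) * (k.1 i : ℝ) := by
    intro i
    have := congrFun hlz i
    simp only [w, Pi.sub_apply, Finset.sum_apply, Pi.smul_apply, smul_eq_mul, sub_mul,
      Finset.sum_sub_distrib] at this ⊢
    push_cast
    rw [← this]
  have hwσ : ∀ i, 0 ≤ σ i * w i := by
    intro i
    have : (0 : ℝ) ≤ (σ i : ℝ) * w i := by
      rw [hwr, Finset.mul_sum]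
      refine Finset.sum_nonneg fun k _ => ?_
      have h1 : (0 : ℝ) ≤ σ i * k.1 i := by exact_mod_cast k.2.2 i
      have h2 : 0 ≤ l k - ⌊l k⌋₊ := sub_nonneg.2 (Nat.floor_le (hl0 k))
      nlinarith [mul_nonneg h1 h2]
    exact_mod_cast this
  obtain ⟨c1, hc1⟩ := hdec w hwΛ hwσ
  have hfin : ∑ k, ((⌊l k⌋₊ + c1 k : ℕ) : ℤ) • k.1 = z := by
    push_cast
    simp only [add_smul, Finset.sum_add_distrib, hc1, w]
    simp
  have hopt : ∑ k, ((⌊l k⌋₊ + c1 k : ℕ) : ℝ) ≤ ∑ k, l k := by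
    refine hlmax _ (fun k => by positivity) ?_
    simpa using hcast (fun k => ((⌊l k⌋₊ + c1 k : ℕ) : ℤ)) z hfin
  set S := Finset.univ.filter (fun k => l k ≠ 0) with hS
  set T := Finset.univ.filter (fun k => c1 k ≠ 0) with hT
  have hTcard : T.card ≤ S.card - 1 := by
    have h1 : T.card ≤ ∑ k, c1 k := by
      rw [Finset.card_eq_sum_ones, hT, Finset.sum_filter]
      refine Finset.sum_le_sum fun k _ => ?_
      split_ifs <;> omega
    have h2 : ((∑ k, c1 k : ℕ) : ℝ) ≤ ∑ k ∈ S, (l k - ⌊l k⌋₊) := by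
      have : ∑ k, (l k - ⌊l k⌋₊) = ∑ k ∈ S, (l k - ⌊l k⌋₊) := by
        symm
        refine Finset.sum_subset (Finset.subset_univ _) fun k _ hk => ?_
        have : l k = 0 := by simpa [hS] using hk
        simp [this]
      rw [← this, Finset.sum_sub_distrib]
      push_cast [Finset.sum_add_distrib] at hopt ⊢
      linarith
    rcases S.eq_empty_or_nonempty with h | h
    · rw [h] at h2 ⊢
      have h3 : ((∑ k, c1 k : ℕ) : ℝ) ≤ ((0 : ℕ) : ℝ) := by simpa using h2
      have h4 := Nat.cast_le.1 h3
      simp; simpa using h1.trans h4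
    · have h3 : ∑ k ∈ S, (l k - ⌊l k⌋₊) < ∑ k ∈ S, (1 : ℝ) :=
        Finset.sum_lt_sum_of_nonempty h fun k _ => by
          have := Nat.lt_floor_add_one (l k); linarith
      have h4 : ((∑ k, c1 k : ℕ) : ℝ) < (S.card : ℝ) := by
        refine h2.trans_lt (h3.trans_eq ?_)
        simp
      have h5 := Nat.cast_lt.1 h4
      omega
  let c : (ι → ℤ) →₀ ℕ := Finsupp.embDomain (Function.Embedding.subtype (fun x => x ∈ G))
    (Finsupp.equivFunOnFinite.symm (fun k : G => ⌊l k⌋₊ + c1 k))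
  have hcG : ∀ g ∈ c.support, g ∈ G := by
    intro g hg
    simp only [c, Finsupp.support_embDomain, Finset.mem_map] at hg
    obtain ⟨a, _, rfl⟩ := hg
    exact a.2
  refine ⟨c, fun g hg => (hcG g hg).1, ?_, ?_, ?_⟩
  · intro g hg g' hg' i
    have h1 := (hcG g hg).2 i
    have h2 := (hcG g' hg').2 i
    calc 0 ≤ (σ i * g i) * (σ i * g' i) := mul_nonneg h1 h2
      _ = (σ i * σ i) * (g i * g' i) := by ring
      _ = _ := by rw [hσσ, one_mul]
  · simp only [c, Finsupp.support_embDomain, Finset.card_map]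
    have : (Finsupp.equivFunOnFinite.symm (fun k : G => ⌊l k⌋₊ + c1 k)).support ⊆ S ∪ T := by
      intro k hk
      simp only [Finsupp.mem_support_iff, Finsupp.equivFunOnFinite_symm_apply_apply] at hk
      simp only [Finset.mem_union, hS, hT, Finset.mem_filter, Finset.mem_univ, true_and]
      by_contra! h
      exact hk (by simp [h.1, h.2])
    have := (Finset.card_le_card this).trans (Finset.card_union_le _ _)
    omega
  · simp only [c]
    rw [Finsupp.sum_embDomain, Finsupp.sum_fintype _ _ (by simp)]
    exact hfin

theorem threeBlock_ker_iff (n sA tA sD tB : ℕ)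
    (A : Matrix (Fin sA) (Fin tA) ℤ) (B : Matrix (Fin sA) (Fin tB) ℤ)
    (D : Matrix (Fin sD) (Fin tA) ℤ) (y : (Fin tB ⊕ Fin n × Fin tA) → ℤ) :
    (threeBlock n sA tA sD tB A B D).mulVec y = 0 ↔
      (∑ k, D.mulVec (fun j => y (Sum.inr (k, j))) = 0) ∧
      ∀ k, B.mulVec (fun j => y (Sum.inl j)) + A.mulVec (fun j => y (Sum.inr (k, j))) = 0 := by
  have h1 : ∀ i, (threeBlock n sA tA sD tB A B D).mulVec y (Sum.inl i) =
      (∑ k, D.mulVec (fun j => y (Sum.inr (k, j)))) i := by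
    intro i
    simp [Matrix.mulVec, dotProduct, threeBlock, Fintype.sum_prod_type]
  have h2 : ∀ k i, (threeBlock n sA tA sD tB A B D).mulVec y (Sum.inr (k, i)) =
      (B.mulVec (fun j => y (Sum.inl j)) + A.mulVec (fun j => y (Sum.inr (k, j)))) i := by
    intro k i
    simp only [Matrix.mulVec, dotProduct, threeBlock, Fintype.sum_prod_type, Fintype.sum_sum_type,
      Matrix.of_apply, Pi.add_apply]
    congr 1
    rw [Finset.sum_eq_single k]
    · simp
    · intro b _ hb
      simp [hb.symm]
    · simp
  constructor
  · intro h
    refine ⟨funext fun i => ?_, fun k => funext fun i => ?_⟩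
    · rw [← h1, h]; rfl
    · rw [← h2, h]; rfl
  · rintro ⟨ha, hb⟩
    funext x
    rcases x with i | ⟨k, i⟩
    · rw [h1, ha]; rfl
    · rw [h2, hb]; rfl

theorem nfold_ker (n sA tA sD tB : ℕ)
    (A : Matrix (Fin sA) (Fin tA) ℤ) (B : Matrix (Fin sA) (Fin tB) ℤ)
    (D : Matrix (Fin sD) (Fin tA) ℤ) (z : (Fin n × Fin tA) → ℤ)
    (h : (threeBlock n sA tA sD tB A B D).mulVec (Sum.elim 0 z) = 0) :
    (nfold n sA tA sD D A).mulVec z = 0 := by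
  funext x
  have := congrFun h x
  rcases x with i | ⟨k, i⟩ <;>
    simpa [Matrix.mulVec, dotProduct, threeBlock, nfold] using this

theorem exists_torsion_mult {s : ℕ} (K : Submodule ℤ (Fin s → ℤ)) :
    ∃ m : ℕ, 2 ≤ m ∧ ∀ u : Fin s → ℤ, (∃ n : ℕ, 1 ≤ n ∧ (n : ℤ) • u ∈ K) → (m : ℤ) • u ∈ K := by
  obtain ⟨a, ha, ha0⟩ := Submodule.annihilator_top_inter_nonZeroDivisors
    (R := ℤ) (M := Submodule.torsion ℤ ((Fin s → ℤ) ⧸ K)) Submodule.torsion_isTorsion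
  have ha0 : a ≠ 0 := nonZeroDivisors.ne_zero ha0
  refine ⟨2 * a.natAbs, by have := Int.natAbs_pos.2 ha0; omega, ?_⟩
  rintro u ⟨n, hn, hu⟩
  have hmem : K.mkQ u ∈ Submodule.torsion ℤ ((Fin s → ℤ) ⧸ K) := by
    refine (Submodule.mem_torsion_iff _).2 ⟨⟨(n : ℤ), mem_nonZeroDivisors_of_ne_zero (by omega)⟩, ?_⟩
    change (n : ℤ) • K.mkQ u = 0
    rw [← map_smul]
    simpa using hu
  have h := (Submodule.mem_annihilator.1 ha) ⟨_, hmem⟩ trivial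
  have h' : a • K.mkQ u = 0 := congrArg Subtype.val h
  rw [← map_smul] at h'
  have h'' : a • u ∈ K := by simpa using h'
  push_cast
  rw [mul_smul]
  refine K.smul_mem _ ?_
  rcases abs_choice a with h | h <;> rw [h]
  · exact h''
  · rw [neg_smul]; exact K.neg_mem h''

def brick {tB tA : ℕ} (w : Fin tB ⊕ Fin 3 × Fin tA → ℤ) (k : Fin 3) : Fin tA → ℤ :=
  fun j => w (Sum.inr (k, j))

def auxLat {sA tA sD tB : ℕ}
    (A : Matrix (Fin sA) (Fin tA) ℤ) (B : Matrix (Fin sA) (Fin tB) ℤ)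
    (D : Matrix (Fin sD) (Fin tA) ℤ) (m r : ℕ) : AddSubgroup (Fin tB ⊕ Fin 3 × Fin tA → ℤ) where
  carrier := {w | (∀ k, B.mulVec (fun j => w (Sum.inl j)) + A.mulVec (brick w k) = 0) ∧
    D.mulVec (brick w 1) = (1 - (m : ℤ)) • D.mulVec (brick w 0) ∧
    D.mulVec (brick w 2) = (1 - (r : ℤ)) • D.mulVec (brick w 0)}
  zero_mem' := by
    have h1 : (fun j : Fin tB => (0 : Fin tB ⊕ Fin 3 × Fin tA → ℤ) (Sum.inl j)) = 0 := rfl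
    have h2 : ∀ k, brick (0 : Fin tB ⊕ Fin 3 × Fin tA → ℤ) k = 0 := fun _ => rfl
    refine ⟨fun k => ?_, ?_, ?_⟩
    · rw [h1, h2, Matrix.mulVec_zero, Matrix.mulVec_zero, add_zero]
    · rw [h2, h2, Matrix.mulVec_zero, smul_zero]
    · rw [h2, h2, Matrix.mulVec_zero, smul_zero]
  add_mem' := by
    rintro a b ⟨a1, a2, a3⟩ ⟨b1, b2, b3⟩
    have h1 : (fun j : Fin tB => (a + b) (Sum.inl j)) =
      (fun j : Fin tB => a (Sum.inl j)) + (fun j : Fin tB => b (Sum.inl j)) := rfl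
    have h2 : ∀ k, brick (a + b) k = brick a k + brick b k := fun _ => rfl
    refine ⟨fun k => ?_, ?_, ?_⟩
    · rw [h1, h2, Matrix.mulVec_add, Matrix.mulVec_add, add_add_add_comm, a1, b1, add_zero]
    · rw [h2, h2, Matrix.mulVec_add, Matrix.mulVec_add, a2, b2, smul_add]
    · rw [h2, h2, Matrix.mulVec_add, Matrix.mulVec_add, a3, b3, smul_add]
  neg_mem' := by
    rintro a ⟨a1, a2, a3⟩
    have h1 : (fun j : Fin tB => (-a) (Sum.inl j)) = -(fun j : Fin tB => a (Sum.inl j)) := rfl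
    have h2 : ∀ k, brick (-a) k = -brick a k := fun _ => rfl
    refine ⟨fun k => ?_, ?_, ?_⟩
    · rw [h1, h2, Matrix.mulVec_neg, Matrix.mulVec_neg, ← neg_add, a1, neg_zero]
    · rw [h2, h2, Matrix.mulVec_neg, Matrix.mulVec_neg, a2, smul_neg]
    · rw [h2, h2, Matrix.mulVec_neg, Matrix.mulVec_neg, a3, smul_neg]

def bty (n a : ℕ) (i : Fin n) : Fin 3 := if i.1 + 1 = n then 2 else if i.1 < a then 1 else 0

theorem sum_bty {M : Type*} [AddCommGroup M] (n a : ℕ) (ha : a < n) (F : Fin 3 → M) :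
    ∑ i, F (bty n a i) = (a : ℤ) • F 1 + ((n : ℤ) - 1 - a) • F 0 + F 2 := by
  obtain ⟨p, rfl⟩ : ∃ p, n = p + 1 := ⟨n - 1, by omega⟩
  rw [Fin.sum_univ_castSucc]
  have h1 : bty (p + 1) a (Fin.last p) = 2 := by simp [bty]
  have h2 : ∀ i : Fin p, F (bty (p + 1) a i.castSucc) = if i.1 < a then F 1 else F 0 := by
    intro i
    have : i.1 ≠ p := i.2.ne
    simp only [bty, Fin.val_castSucc, Nat.add_right_cancel_iff, this, if_false]
    split_ifs <;> rfl
  rw [h1]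
  simp only [h2]
  rw [Fin.sum_univ_eq_sum_range (fun i => if i < a then F 1 else F 0)]
  congr 1
  obtain ⟨b, rfl⟩ : ∃ b, p = a + b := ⟨p - a, by omega⟩
  rw [Finset.sum_range_add]
  congr 1
  · rw [Finset.sum_congr rfl (g := fun _ => F 1)]
    · simp
    · intro i hi; simp [Finset.mem_range.1 hi]
  · simp

def expand {tB tA : ℕ} (n a : ℕ) (w : Fin tB ⊕ Fin 3 × Fin tA → ℤ) :
    Fin tB ⊕ Fin n × Fin tA → ℤ :=
  w ∘ Sum.map id (Prod.map (bty n a) id)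

theorem expand_ker {sA tA sD tB : ℕ}
    (A : Matrix (Fin sA) (Fin tA) ℤ) (B : Matrix (Fin sA) (Fin tB) ℤ)
    (D : Matrix (Fin sD) (Fin tA) ℤ) (m r n a : ℕ) (hn : n = a * m + r) (ha : a < n)
    (w : Fin tB ⊕ Fin 3 × Fin tA → ℤ) (hw : w ∈ auxLat A B D m r) :
    (threeBlock n sA tA sD tB A B D).mulVec (expand n a w) = 0 := by
  obtain ⟨h1, h2, h3⟩ := hw
  rw [threeBlock_ker_iff]
  refine ⟨?_, fun k => h1 _⟩
  change ∑ k, D.mulVec (brick w (bty n a k)) = 0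
  rw [sum_bty n a ha (fun k => D.mulVec (brick w k)), h2, h3, smul_smul, ← add_smul, ← add_smul]
  convert zero_smul ℤ _
  rw [hn]; push_cast; ring

theorem lift_aux {sA tA sD tB : ℕ}
    (A : Matrix (Fin sA) (Fin tA) ℤ) (B : Matrix (Fin sA) (Fin tB) ℤ)
    (D : Matrix (Fin sD) (Fin tA) ℤ) :
    ∃ m : ℕ, 2 ≤ m ∧ ∀ n, 1 ≤ n → ∀ y, (threeBlock n sA tA sD tB A B D).mulVec y = 0 →
      ∃ w ∈ auxLat A B D m (n % m), ∀ j, w (Sum.inl j) = y (Sum.inl j) := by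
  let K : Submodule ℤ (Fin sD → ℤ) := (LinearMap.ker A.mulVecLin).map D.mulVecLin
  have hK : ∀ u, u ∈ K ↔ ∃ x, A.mulVec x = 0 ∧ D.mulVec x = u := by
    intro u; simp [K]
  obtain ⟨m, hm, hmK⟩ := exists_torsion_mult K
  refine ⟨m, hm, fun n hn y hy => ?_⟩
  rw [threeBlock_ker_iff] at hy
  obtain ⟨hD, hA⟩ := hy
  let x : Fin tA → ℤ := fun j => y (Sum.inr (⟨0, hn⟩, j))
  have hx := hA ⟨0, hn⟩
  have hnx : (n : ℤ) • D.mulVec x ∈ K := by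
    have : (n : ℤ) • D.mulVec x = ∑ k : Fin n, D.mulVec (x - fun j => y (Sum.inr (k, j))) := by
      simp only [Matrix.mulVec_sub, Finset.sum_sub_distrib, hD]
      simp
    rw [this]
    refine K.sum_mem fun k _ => (hK _).2 ⟨_, ?_, rfl⟩
    rw [Matrix.mulVec_sub, sub_eq_zero]
    exact add_left_cancel (hx.trans (hA k).symm)
  have hmx := hmK _ ⟨n, hn, hnx⟩
  have hrx : ((n % m : ℕ) : ℤ) • D.mulVec x ∈ K := by
    have : ((n % m : ℕ) : ℤ) • D.mulVec x =
        (n : ℤ) • D.mulVec x - ((n / m : ℕ) : ℤ) • (m : ℤ) • D.mulVec x := by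
      rw [smul_smul, ← sub_smul]
      congr 1
      have : ((n / m * m + n % m : ℕ) : ℤ) = n := by rw [Nat.div_add_mod']
      push_cast at this ⊢
      linarith
    rw [this]
    exact K.sub_mem hnx (K.smul_mem _ hmx)
  obtain ⟨k1, hk1, hk1'⟩ := (hK _).1 hmx
  obtain ⟨k2, hk2, hk2'⟩ := (hK _).1 hrx
  let w : Fin tB ⊕ Fin 3 × Fin tA → ℤ :=
    Sum.elim (fun j => y (Sum.inl j)) (fun p => (![x, x - k1, x - k2] p.1) p.2)
  have b0 : brick w 0 = x := rfl
  have b1 : brick w 1 = x - k1 := rfl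
  have b2 : brick w 2 = x - k2 := rfl
  refine ⟨w, ⟨?_, ?_, ?_⟩, fun j => rfl⟩
  · intro k
    fin_cases k
    · exact hx
    · change B.mulVec _ + A.mulVec (brick w 1) = 0
      rw [b1, Matrix.mulVec_sub, hk1, sub_zero]; exact hx
    · change B.mulVec _ + A.mulVec (brick w 2) = 0
      rw [b2, Matrix.mulVec_sub, hk2, sub_zero]; exact hx
  · rw [b0, b1, Matrix.mulVec_sub, hk1', sub_smul, one_smul]
  · rw [b0, b2, Matrix.mulVec_sub, hk2', sub_smul, one_smul]

theorem conformal_sign {ι : Type*} {x x' y : ι → ℤ} (h : conformal x y) (h' : conformal x' y)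
    (i : ι) : 0 ≤ x i * x' i := by
  have h1 := conformal_iff_nat.1 h i
  have h2 := conformal_iff_nat.1 h' i
  rcases le_total 0 (y i) with hy | hy
  · exact mul_nonneg (by omega) (by omega)
  · exact mul_nonneg_of_nonpos_of_nonpos (by omega) (by omega)

def GoodN {sA tA sD tB : ℕ}
    (A : Matrix (Fin sA) (Fin tA) ℤ) (B : Matrix (Fin sA) (Fin tB) ℤ)
    (D : Matrix (Fin sD) (Fin tA) ℤ) (N : ℕ) : Prop :=
  ∀ n : ℕ, 1 ≤ n → ∀ y : (Fin tB ⊕ Fin n × Fin tA) → ℤ,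
    (threeBlock n sA tA sD tB A B D).mulVec y = 0 →
    ∃ (e : Fin N → (Fin tB ⊕ Fin n × Fin tA) → ℤ) (α : Fin N → ℕ),
      (∀ h, (threeBlock n sA tA sD tB A B D).mulVec (e h) = 0) ∧
      (∀ h, ∀ j : Fin tB, |e h (Sum.inl j)| ≤ |y (Sum.inl j)| ∧
        0 ≤ e h (Sum.inl j) * y (Sum.inl j)) ∧
      (∀ h i, |e h i| ≤ (N : ℤ)) ∧
      (∀ h h' : Fin N, ∀ i, 0 ≤ e h i * e h' i) ∧
      (∀ j, y (Sum.inl j) = ∑ h, (α h : ℤ) * e h (Sum.inl j))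

open Filter in
theorem good_eventually {sA tA sD tB : ℕ}
    (A : Matrix (Fin sA) (Fin tA) ℤ) (B : Matrix (Fin sA) (Fin tB) ℤ)
    (D : Matrix (Fin sD) (Fin tA) ℤ) : ∀ᶠ N in atTop, GoodN A B D N := by
  classical
  obtain ⟨m, hm, hlift⟩ := lift_aux A B D
  have hev : ∀ᶠ N : ℕ in atTop, ∀ r ∈ Set.Iio m,
      (lgraver_finite (auxLat A B D m r)).toFinset.card ≤ N ∧
      ∀ g ∈ lgraver (auxLat A B D m r), ∀ i ∈ (Set.univ : Set (Fin tB ⊕ Fin 3 × Fin tA)),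
        (g i).natAbs ≤ N := by
    rw [Filter.eventually_all_finite (Set.finite_Iio m)]
    intro r _
    refine (eventually_ge_atTop _).and ?_
    rw [Filter.eventually_all_finite (lgraver_finite _)]
    intro g _
    rw [Filter.eventually_all_finite Set.finite_univ]
    intro i _
    exact eventually_ge_atTop _
  filter_upwards [hev] with N hN n hn y hy
  obtain ⟨hcard, hbd⟩ := hN (n % m) (Nat.mod_lt _ (by omega))
  obtain ⟨w, hw, hwy⟩ := hlift n hn y hy
  obtain ⟨c, hc, hcw⟩ := lgraver_decomp _ _ w hw le_rfl
  have hcc : c.support.card ≤ N := by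
    refine (Finset.card_le_card fun g hg => ?_).trans hcard
    simpa using (hc g hg).1
  have ha : n / m < n := Nat.div_lt_self hn (by omega)
  let eq := c.support.equivFin
  let v : Fin N → (Fin tB ⊕ Fin 3 × Fin tA → ℤ) :=
    fun h => if hh : h.1 < c.support.card then (eq.symm ⟨h.1, hh⟩).1 else 0
  have hv : ∀ h, (v h ∈ lgraver (auxLat A B D m (n % m)) ∧ conformal (v h) w) ∨ v h = 0 := by
    intro h
    simp only [v]
    split_ifs with hh
    · exact Or.inl (hc _ (eq.symm ⟨h.1, hh⟩).2)
    · exact Or.inr rfl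
  have hvc : ∀ h, conformal (v h) w := by
    intro h
    rcases hv h with h1 | h1
    · exact h1.2
    · rw [h1]; intro i; simp
  refine ⟨fun h => expand n (n / m) (v h),
    fun h => if h.1 < c.support.card then c (v h) else 0, ?_, ?_, ?_, ?_, ?_⟩
  · intro h
    refine expand_ker A B D m (n % m) n (n / m) (Nat.div_add_mod' n m).symm ha _ ?_
    rcases hv h with h1 | h1
    · exact h1.1.1
    · rw [h1]; exact AddSubgroup.zero_mem _
  · intro h j
    have := hvc h (Sum.inl j)
    rw [hwy] at this
    exact this
  · intro h i
    rcases hv h with h1 | h1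
    · have := hbd _ h1.1 (Sum.map id (Prod.map (bty n (n / m)) id) i) trivial
      simp only [expand, Function.comp]
      rw [Int.abs_eq_natAbs]
      exact_mod_cast this
    · simp [expand, h1]
  · intro h h' i
    exact conformal_sign (hvc h) (hvc h') _
  · intro j
    have h1 := congrFun hcw (Sum.inl j)
    rw [hwy, Finsupp.sum, Finset.sum_apply] at h1
    rw [← h1]
    obtain ⟨p, rfl⟩ : ∃ p, N = c.support.card + p := ⟨N - c.support.card, by omega⟩
    rw [Fin.sum_univ_add]
    have h2 : ∀ x : Fin p, ((if (Fin.natAdd c.support.card x).1 < c.support.card then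
      c (v (Fin.natAdd c.support.card x)) else 0 : ℕ) : ℤ) = 0 := by intro x; simp
    simp only [h2, zero_mul, Finset.sum_const_zero, add_zero]
    rw [← Finset.sum_coe_sort c.support, ← Equiv.sum_comp eq.symm]
    refine Finset.sum_congr rfl fun x _ => ?_
    have h3 : v (Fin.castAdd p x) = (eq.symm x).1 := by simp [v]
    simp [h3, expand]

theorem bounded_matrix_finite (s t Δ : ℕ) :
    {A : Matrix (Fin s) (Fin t) ℤ | ∀ i j, |A i j| ≤ (Δ : ℤ)}.Finite := by
  have h : {A : Fin s → Fin t → ℤ | ∀ i, A i ∈ {f : Fin t → ℤ | ∀ j, f j ∈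
      Set.Icc (-(Δ : ℤ)) Δ}}.Finite :=
    Set.Finite.pi' fun _ => Set.Finite.pi' fun _ => Set.finite_Icc _ _
  exact h.subset fun A hA i j => abs_le.1 (hA i j)

/-- Every kernel element `y` of a 3-block n-fold matrix decomposes as a conic combination
of `q` bounded kernel elements `e_h` with `e_h^0 ⊑ y^0`, lying in a common orthant,
plus a conic combination of at most `2·n·t_A − 1` pairwise sign-compatible vectors
`(0, g_ℓ(E))` with `g_ℓ(E) ∈ G(E)`. -/
theorem two_orthant_decomposition_threeBlock
    (sA tA sD tB Δ : ℕ) (hsA : 0 < sA) (htA : 0 < tA) (hsD : 0 < sD)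
    (htB : 0 < tB) (hΔ : 0 < Δ) :
    ∃ q ξ' : ℕ, ∀ n : ℕ, 1 ≤ n →
      ∀ (A : Matrix (Fin sA) (Fin tA) ℤ) (B : Matrix (Fin sA) (Fin tB) ℤ)
        (D : Matrix (Fin sD) (Fin tA) ℤ),
      (∀ i j, |A i j| ≤ (Δ : ℤ)) → (∀ i j, |B i j| ≤ (Δ : ℤ)) →
      (∀ i j, |D i j| ≤ (Δ : ℤ)) →
      ∀ y : (Fin tB ⊕ Fin n × Fin tA) → ℤ,
        (threeBlock n sA tA sD tB A B D).mulVec y = 0 →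
        ∃ (e : Fin q → (Fin tB ⊕ Fin n × Fin tA) → ℤ)
          (α : Fin q → ℕ) (L : ℕ) (β : Fin L → ℕ)
          (gE : Fin L → (Fin n × Fin tA) → ℤ),
          L ≤ 2 * n * tA - 1 ∧
          (∀ h, (threeBlock n sA tA sD tB A B D).mulVec (e h) = 0) ∧
          (∀ h, ∀ j : Fin tB, |e h (Sum.inl j)| ≤ |y (Sum.inl j)| ∧
            0 ≤ e h (Sum.inl j) * y (Sum.inl j)) ∧
          (∀ h i, |e h i| ≤ (ξ' : ℤ)) ∧
          (∀ ℓ, gE ℓ ∈ graverBasis (nfold n sA tA sD D A)) ∧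
          (∀ h h' : Fin q, ∀ i, 0 ≤ e h i * e h' i) ∧
          (∀ ℓ ℓ' : Fin L, ∀ p : Fin n × Fin tA, 0 ≤ gE ℓ p * gE ℓ' p) ∧
          y = (∑ h, (α h : ℤ) • e h) +
            ∑ ℓ, (β ℓ : ℤ) • (Sum.elim (0 : Fin tB → ℤ) (gE ℓ)) := by
  classical
  have hev : ∀ᶠ N in Filter.atTop,
      ∀ A ∈ {A : Matrix (Fin sA) (Fin tA) ℤ | ∀ i j, |A i j| ≤ (Δ : ℤ)},
      ∀ B ∈ {B : Matrix (Fin sA) (Fin tB) ℤ | ∀ i j, |B i j| ≤ (Δ : ℤ)},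
      ∀ D ∈ {D : Matrix (Fin sD) (Fin tA) ℤ | ∀ i j, |D i j| ≤ (Δ : ℤ)}, GoodN A B D N := by
    rw [Filter.eventually_all_finite (bounded_matrix_finite _ _ _)]
    intro A _
    rw [Filter.eventually_all_finite (bounded_matrix_finite _ _ _)]
    intro B _
    rw [Filter.eventually_all_finite (bounded_matrix_finite _ _ _)]
    intro D _
    exact good_eventually A B D
  obtain ⟨N, hN⟩ := hev.exists
  refine ⟨N, N, fun n hn A B D hA hB hD y hy => ?_⟩
  obtain ⟨e, α, he, hc, hb, hs, hy0⟩ := hN A hA B hB D hD n hn y hy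
  let Λ : AddSubgroup (Fin n × Fin tA → ℤ) :=
    (LinearMap.ker (nfold n sA tA sD D A).mulVecLin).toAddSubgroup
  have hΛ : ∀ x, x ∈ Λ ↔ (nfold n sA tA sD D A).mulVec x = 0 := by
    intro x; simp [Λ]
  let u := y - ∑ h, (α h : ℤ) • e h
  let z : Fin n × Fin tA → ℤ := fun p => u (Sum.inr p)
  have hu : u = Sum.elim (0 : Fin tB → ℤ) z := by
    funext x
    rcases x with j | p
    · simp [u, hy0 j]
    · rfl
  have hz : z ∈ Λ := by
    rw [hΛ]
    refine nfold_ker n sA tA sD tB A B D z ?_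
    rw [← hu]
    simp only [u]
    rw [Matrix.mulVec_sub, hy, Matrix.mulVec_sum, Finset.sum_eq_zero, sub_zero]
    intro h _
    rw [Matrix.mulVec_smul, he, smul_zero]
  obtain ⟨c, hcG, hcs, hcc, hcz⟩ := cfs Λ (by simp; exact ⟨by omega, htA⟩) z hz
  let eq := c.support.equivFin
  refine ⟨e, α, c.support.card, fun l => c (eq.symm l).1, fun l => (eq.symm l).1, ?_, he, hc, hb,
    ?_, hs, ?_, ?_⟩
  · simpa [mul_assoc] using hcc
  · intro l
    obtain ⟨h1, h2, h3⟩ := hcG _ (eq.symm l).2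
    exact ⟨(hΛ _).1 h1, h2, fun z hz => h3 z ((hΛ _).2 hz)⟩
  · intro l l' p
    exact hcs _ (eq.symm l).2 _ (eq.symm l').2 p
  · have h1 : y = ∑ h, (α h : ℤ) • e h + u := by simp [u]
    have h2 : u = ∑ l, ((c (eq.symm l).1 : ℕ) : ℤ) •
        (Sum.elim (0 : Fin tB → ℤ) ((eq.symm l).1)) := by
      rw [hu, ← hcz, Finsupp.sum,
        Equiv.sum_comp eq.symm (fun g => ((c g.1 : ℕ) : ℤ) • (Sum.elim (0 : Fin tB → ℤ) g.1)),
        Finset.sum_coe_sort c.support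
          (fun g => ((c g : ℕ) : ℤ) • (Sum.elim (0 : Fin tB → ℤ) g))]
      funext x
      rcases x with j | p <;> simp
    rw [← h2]
    exact h1
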